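/- Let d ≥ 1 and let f : ℝ^d → ℝ be ℓ-smooth, twice continuously differentiable and ρ-Hessian Lipschitz. For any x ∈ ℝ^d and any v ∈ ℝ^d with v ≠ 0, form the zeroth-order Hessian-vector product estimator 𝓗_f(x)v with smoothing parameter μ = ‖v‖. Then |vᵀ𝓗_f(x)v − vᵀ∇²f(x)v| ≤ ρ√d‖v‖³, and moreover |vᵀ𝓗_f(x)v| ≤ ρ√d‖v‖³ + ℓ‖v‖². -/

import Mathlib

open scoped RealInnerProductSpace

/-- The zeroth-order Hessian-vector product estimator
`𝓗_f(x)v = Σ_i ((f(x+v+μeᵢ) − f(x+v−μeᵢ) + f(x−μeᵢ) − f(x+μeᵢ))/(2μ)) eᵢ`. -/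
noncomputable def zoHvp (d : ℕ) (f : EuclideanSpace ℝ (Fin d) → ℝ) (μ : ℝ)
    (x v : EuclideanSpace ℝ (Fin d)) : EuclideanSpace ℝ (Fin d) :=
  ∑ i : Fin d,
    ((f (x + v + μ • EuclideanSpace.single i 1) - f (x + v - μ • EuclideanSpace.single i 1)
        + f (x - μ • EuclideanSpace.single i 1) - f (x + μ • EuclideanSpace.single i 1)) / (2 * μ))
      • EuclideanSpace.single i 1

/-- Second-order Taylor bound for a map whose derivative is `ρ`-Lipschitz. -/
theorem norm_sub_sub_fderiv_le_of_lipschitz_fderiv {E F : Type*}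
    [NormedAddCommGroup E] [NormedSpace ℝ E] [NormedAddCommGroup F] [NormedSpace ℝ F]
    {G : E → F} {ρ : ℝ} (hG : Differentiable ℝ G)
    (hLip : ∀ x y : E, ‖fderiv ℝ G x - fderiv ℝ G y‖ ≤ ρ * ‖x - y‖) (y v : E) :
    ‖G (y + v) - G y - fderiv ℝ G y v‖ ≤ ρ / 2 * ‖v‖ ^ 2 := by
  have hder : ∀ s : ℝ, HasDerivAt (fun s : ℝ => G (y + s • v) - G y - s • fderiv ℝ G y v)
      (fderiv ℝ G (y + s • v) v - fderiv ℝ G y v) s := by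
    intro s
    have hline : HasDerivAt (fun s : ℝ => y + s • v) v s := by
      simpa using ((hasDerivAt_id s).smul_const v).const_add y
    have hlin : HasDerivAt (fun s : ℝ => s • fderiv ℝ G y v) (fderiv ℝ G y v) s := by
      simpa using (hasDerivAt_id s).smul_const (fderiv ℝ G y v)
    exact (((hG _).hasFDerivAt.comp_hasDerivAt s hline).sub_const (G y)).sub hlin
  have hbound : ∀ s : ℝ, HasDerivAt (fun s : ℝ => ρ / 2 * ‖v‖ ^ 2 * s ^ 2)
      (ρ * ‖v‖ ^ 2 * s) s := by
    intro s
    exact ((hasDerivAt_pow 2 s).const_mul (ρ / 2 * ‖v‖ ^ 2)).congr_deriv (by push_cast; ring)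
  have key := image_norm_le_of_norm_deriv_right_le_deriv_boundary (a := 0) (b := 1)
    (fun s _ => (hder s).continuousAt.continuousWithinAt)
    (fun s _ => (hder s).hasDerivWithinAt) (by simp) hbound
    (fun s hs => by
      calc ‖fderiv ℝ G (y + s • v) v - fderiv ℝ G y v‖
          ≤ ‖fderiv ℝ G (y + s • v) - fderiv ℝ G y‖ * ‖v‖ :=
            (fderiv ℝ G (y + s • v) - fderiv ℝ G y).le_opNorm v
        _ ≤ ρ * ‖y + s • v - y‖ * ‖v‖ := by gcongr; exact hLip _ _
        _ = ρ * ‖v‖ ^ 2 * s := by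
            rw [add_sub_cancel_left, norm_smul, Real.norm_of_nonneg hs.1]; ring)
    (Set.right_mem_Icc.2 zero_le_one)
  simpa using key

section Gradient

variable {E : Type*} [NormedAddCommGroup E] [InnerProductSpace ℝ E] [CompleteSpace E] {f : E → ℝ}

theorem ContDiff.differentiable_gradient (hf : ContDiff ℝ 2 f) :
    Differentiable ℝ (gradient f) :=
  (InnerProductSpace.toDual ℝ E).symm.differentiable.comp
    ((hf.fderiv_right (m := 1) (by norm_num)).differentiable one_ne_zero)

theorem hasDerivAt_comp_add_smul_gradient (hf : Differentiable ℝ f) (p e : E) (t : ℝ) :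
    HasDerivAt (fun t : ℝ => f (p + t • e)) ⟪gradient f (p + t • e), e⟫ t := by
  have hline : HasDerivAt (fun t : ℝ => p + t • e) e t := by
    simpa using ((hasDerivAt_id t).smul_const e).const_add p
  exact (hf (p + t • e)).hasGradientAt.hasFDerivAt.comp_hasDerivAt t hline

variable {ρ : ℝ}

theorem abs_inner_gradient_sub_sub_hessian_le (hf : ContDiff ℝ 2 f)
    (hLip : ∀ x y : E, ‖fderiv ℝ (gradient f) x - fderiv ℝ (gradient f) y‖ ≤ ρ * ‖x - y‖)
    (x v : E) {e : E} (he : ‖e‖ = 1) (t : ℝ) :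
    |⟪gradient f (x + v + t • e), e⟫ - ⟪gradient f (x + t • e), e⟫
        - ⟪fderiv ℝ (gradient f) x v, e⟫| ≤ ρ / 2 * ‖v‖ ^ 2 + ρ * |t| * ‖v‖ := by
  have htaylor := norm_sub_sub_fderiv_le_of_lipschitz_fderiv hf.differentiable_gradient hLip
    (x + t • e) v
  have hhess : ‖(fderiv ℝ (gradient f) (x + t • e) - fderiv ℝ (gradient f) x) v‖
      ≤ ρ * |t| * ‖v‖ := by
    refine (ContinuousLinearMap.le_opNorm _ v).trans ?_
    gcongr
    simpa [norm_smul, he] using hLip (x + t • e) x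
  rw [← inner_sub_left, ← inner_sub_left]
  refine (abs_real_inner_le_norm _ _).trans ?_
  rw [he, mul_one]
  refine le_trans (le_of_eq ?_) ((norm_add_le _ _).trans (add_le_add htaylor hhess))
  rw [sub_apply, add_right_comm x v]
  congr 1
  abel

/-- The mixed second difference of `f` approximates the Hessian bilinear form. -/
theorem abs_mixed_difference_sub_hessian_le (hf : ContDiff ℝ 2 f)
    (hLip : ∀ x y : E, ‖fderiv ℝ (gradient f) x - fderiv ℝ (gradient f) y‖ ≤ ρ * ‖x - y‖)
    (x v : E) {e : E} (he : ‖e‖ = 1) {μ : ℝ} (hμ : 0 ≤ μ) :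
    |f (x + v + μ • e) - f (x + v - μ • e) + f (x - μ • e) - f (x + μ • e)
        - 2 * μ * ⟪fderiv ℝ (gradient f) x v, e⟫| ≤ ρ * ‖v‖ ^ 2 * μ + ρ * ‖v‖ * μ ^ 2 := by
  set c := ⟪fderiv ℝ (gradient f) x v, e⟫
  have hfd : Differentiable ℝ f := hf.differentiable two_ne_zero
  have hneg : ∀ (p : E) (t : ℝ), HasDerivAt (fun t : ℝ => f (p + (-t) • e))
      (-⟪gradient f (p + (-t) • e), e⟫) t := fun p t =>
    ((hasDerivAt_comp_add_smul_gradient hfd p e (-t)).comp t (hasDerivAt_neg t)).congr_deriv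
      (mul_neg_one _)
  have hder : ∀ t : ℝ, HasDerivAt
      (fun t : ℝ => f (x + v + t • e) - f (x + v + (-t) • e) + f (x + (-t) • e) - f (x + t • e)
        - 2 * t * c)
      (⟪gradient f (x + v + t • e), e⟫ - -⟪gradient f (x + v + (-t) • e), e⟫
        + -⟪gradient f (x + (-t) • e), e⟫ - ⟪gradient f (x + t • e), e⟫ - 2 * c) t := fun t =>
    ((((hasDerivAt_comp_add_smul_gradient hfd (x + v) e t).sub (hneg (x + v) t)).add
      (hneg x t)).sub (hasDerivAt_comp_add_smul_gradient hfd x e t)).sub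
      (by simpa using ((hasDerivAt_id t).const_mul 2).mul_const c)
  have hbound : ∀ t : ℝ, HasDerivAt (fun t : ℝ => ρ * ‖v‖ ^ 2 * t + ρ * ‖v‖ * t ^ 2)
      (ρ * ‖v‖ ^ 2 + ρ * ‖v‖ * (2 * t)) t := fun t =>
    (((hasDerivAt_id t).const_mul (ρ * ‖v‖ ^ 2)).add
      ((hasDerivAt_pow 2 t).const_mul (ρ * ‖v‖))).congr_deriv (by simp)
  have key := image_norm_le_of_norm_deriv_right_le_deriv_boundary (a := 0) (b := μ)
    (fun t _ => (hder t).continuousAt.continuousWithinAt)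
    (fun t _ => (hder t).hasDerivWithinAt) (by simp) hbound
    (fun t ht => by
      have hpos := abs_le.1 (abs_inner_gradient_sub_sub_hessian_le hf hLip x v he t)
      have hneg := abs_le.1 (abs_inner_gradient_sub_sub_hessian_le hf hLip x v he (-t))
      rw [abs_neg] at hneg
      rw [abs_of_nonneg ht.1] at hpos hneg
      rw [Real.norm_eq_abs, abs_le]
      constructor <;> linarith [hpos.1, hpos.2, hneg.1, hneg.2])
    (Set.right_mem_Icc.2 hμ)
  simpa only [neg_smul, ← sub_eq_add_neg, Real.norm_eq_abs] using key

end Gradient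

theorem EuclideanSpace.norm_le_sqrt_card_mul {d : ℕ} {w : EuclideanSpace ℝ (Fin d)} {C : ℝ}
    (hC : 0 ≤ C) (hw : ∀ i, |w i| ≤ C) : ‖w‖ ≤ Real.sqrt d * C := by
  rw [EuclideanSpace.norm_eq, ← Real.sqrt_sq hC, ← Real.sqrt_mul d.cast_nonneg]
  refine Real.sqrt_le_sqrt ?_
  calc ∑ i, ‖w i‖ ^ 2 ≤ ∑ _i : Fin d, C ^ 2 :=
        Finset.sum_le_sum fun i _ => pow_le_pow_left₀ (norm_nonneg _) (hw i) 2
    _ = d * C ^ 2 := by simp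

theorem zoHvp_apply (d : ℕ) (f : EuclideanSpace ℝ (Fin d) → ℝ) (μ : ℝ)
    (x v : EuclideanSpace ℝ (Fin d)) (i : Fin d) :
    zoHvp d f μ x v i =
      (f (x + v + μ • EuclideanSpace.single i 1) - f (x + v - μ • EuclideanSpace.single i 1)
        + f (x - μ • EuclideanSpace.single i 1) - f (x + μ • EuclideanSpace.single i 1))
        / (2 * μ) := by
  simp [zoHvp, Pi.single_apply]

/-- With smoothing parameter `‖v‖`, the estimator is within `ρ√d‖v‖²` of `∇²f(x)v`. -/
theorem norm_zoHvp_sub_hessian_le {d : ℕ} {f : EuclideanSpace ℝ (Fin d) → ℝ} {ρ : ℝ}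
    (hf : ContDiff ℝ 2 f)
    (hLip : ∀ x y : EuclideanSpace ℝ (Fin d),
      ‖fderiv ℝ (gradient f) x - fderiv ℝ (gradient f) y‖ ≤ ρ * ‖x - y‖)
    (x : EuclideanSpace ℝ (Fin d)) {v : EuclideanSpace ℝ (Fin d)} (hv : v ≠ 0) :
    ‖zoHvp d f ‖v‖ x v - fderiv ℝ (gradient f) x v‖ ≤ Real.sqrt d * (ρ * ‖v‖ ^ 2) := by
  have hvpos : 0 < ‖v‖ := norm_pos_iff.2 hv
  have hρ : 0 ≤ ρ := nonneg_of_mul_nonneg_left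
    ((norm_nonneg _).trans (by simpa using hLip v 0)) hvpos
  refine EuclideanSpace.norm_le_sqrt_card_mul (by positivity) fun i => ?_
  have hmixed := abs_mixed_difference_sub_hessian_le hf hLip x v
    (e := EuclideanSpace.single i (1 : ℝ)) (by simp) hvpos.le
  rw [EuclideanSpace.inner_single_right] at hmixed
  simp only [one_mul, conj_trivial] at hmixed
  have hdiv : ∀ a b : ℝ, a / (2 * ‖v‖) - b = (a - 2 * ‖v‖ * b) / (2 * ‖v‖) := fun a b => by
    field_simp
  rw [PiLp.sub_apply, zoHvp_apply, hdiv, abs_div, abs_of_pos (by positivity : 0 < 2 * ‖v‖),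
    div_le_iff₀ (by positivity)]
  exact hmixed.trans_eq (by ring)

/-- If `f : ℝ^d → ℝ` (`d ≥ 1`) is `ℓ`-smooth, twice continuously differentiable and
`ρ`-Hessian Lipschitz, then for `v ≠ 0` and the estimator taken with `μ = ‖v‖`,
`|vᵀ𝓗_f(x)v − vᵀ∇²f(x)v| ≤ ρ√d‖v‖³` and `|vᵀ𝓗_f(x)v| ≤ ρ√d‖v‖³ + ℓ‖v‖²`. -/
theorem zoHvp_quadratic_form_bound (d : ℕ) (hd : 1 ≤ d)
    (f : EuclideanSpace ℝ (Fin d) → ℝ) (ℓ ρ : ℝ)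
    (hf : ContDiff ℝ 2 f)
    (hGradLip : ∀ x y : EuclideanSpace ℝ (Fin d), ‖gradient f x - gradient f y‖ ≤ ℓ * ‖x - y‖)
    (hHessLip : ∀ x y : EuclideanSpace ℝ (Fin d),
      ‖fderiv ℝ (gradient f) x - fderiv ℝ (gradient f) y‖ ≤ ρ * ‖x - y‖)
    (x v : EuclideanSpace ℝ (Fin d)) (hv : v ≠ 0) :
    |⟪v, zoHvp d f ‖v‖ x v⟫ - ⟪v, fderiv ℝ (gradient f) x v⟫|
        ≤ ρ * Real.sqrt d * ‖v‖ ^ 3 ∧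
      |⟪v, zoHvp d f ‖v‖ x v⟫| ≤ ρ * Real.sqrt d * ‖v‖ ^ 3 + ℓ * ‖v‖ ^ 2 := by
  have hvpos : 0 < ‖v‖ := norm_pos_iff.2 hv
  have hℓ : 0 ≤ ℓ := nonneg_of_mul_nonneg_left
    ((norm_nonneg _).trans (by simpa using hGradLip v 0)) hvpos
  have herr : |⟪v, zoHvp d f ‖v‖ x v⟫ - ⟪v, fderiv ℝ (gradient f) x v⟫|
      ≤ ρ * Real.sqrt d * ‖v‖ ^ 3 := by
    rw [← inner_sub_right]
    calc |⟪v, zoHvp d f ‖v‖ x v - fderiv ℝ (gradient f) x v⟫|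
        ≤ ‖v‖ * ‖zoHvp d f ‖v‖ x v - fderiv ℝ (gradient f) x v‖ := abs_real_inner_le_norm _ _
      _ ≤ ‖v‖ * (Real.sqrt d * (ρ * ‖v‖ ^ 2)) := by
          gcongr; exact norm_zoHvp_sub_hessian_le hf hHessLip x hv
      _ = ρ * Real.sqrt d * ‖v‖ ^ 3 := by ring
  have hquad : |⟪v, fderiv ℝ (gradient f) x v⟫| ≤ ℓ * ‖v‖ ^ 2 := by
    have hop : ‖fderiv ℝ (gradient f) x‖ ≤ ℓ :=
      norm_fderiv_le_of_lip' ℝ hℓ (Filter.Eventually.of_forall fun y => hGradLip y x)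
    calc |⟪v, fderiv ℝ (gradient f) x v⟫|
        ≤ ‖v‖ * ‖fderiv ℝ (gradient f) x v‖ := abs_real_inner_le_norm _ _
      _ ≤ ‖v‖ * (ℓ * ‖v‖) := by gcongr; exact ContinuousLinearMap.le_of_opNorm_le _ hop v
      _ = ℓ * ‖v‖ ^ 2 := by ring
  refine ⟨herr, ?_⟩
  have htri := abs_add_le (⟪v, zoHvp d f ‖v‖ x v⟫ - ⟪v, fderiv ℝ (gradient f) x v⟫)
    ⟪v, fderiv ℝ (gradient f) x v⟫
  rw [sub_add_cancel] at htri
  exact htri.trans (add_le_add herr hquad)
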